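/- In BC_{r,t}, for every n ∈ ℕ and every admissible i one has e_i ȳ_i^{2n+1} = Σ_{j=0}^{n} a^{(i)}_{2n+1,j} e_i y_i^{2j+1} for elements a^{(i)}_{2n+1,j} of the polynomial subring R[ω_{3,i}, …, ω_{2n−1,i}] satisfying: (1) a^{(i)}_{2n+1,n} = −1; (2) a^{(i)}_{2n+1,j} = a^{(i)}_{2n−1,j−1} for 1 ≤ j ≤ n; (3) a^{(i)}_{2n+1,0} = Σ_{j=1}^{n−1} a^{(i)}_{2n−1,j} ω_{2j+1,i}. -/

import Mathlib

open Polynomial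

noncomputable section

/-- Transposition `(a b)` (0-based indices) in the symmetric group on `Fin n`;
it is `1` if an index is out of range. -/
def sw (n a b : ℕ) : Equiv.Perm (Fin n) :=
  if h : a < n ∧ b < n then Equiv.swap ⟨a, h.1⟩ ⟨b, h.2⟩ else 1

/-- The permutation word `s_{i,j}` of the paper (1-based indices):
`s_{i,j} = s_i s_{i+1,j}` for `i < j`, `s_{i,i} = 1`, `s_{i,j} = s_{i,j+1} s_j` for `i > j`. -/
def sIJ (n i j : ℕ) : Equiv.Perm (Fin n) :=
  if i < j then ((List.range' i (j - i)).map (fun k => sw n (k - 1) k)).prod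
  else ((List.range' j (i - j)).reverse.map (fun k => sw n (k - 1) k)).prod

/-- The coefficients `a_{2n+1,j}` of the paper: `acoef ω n j = a_{2n+1,j}`, defined by the
recursion `a_{1,0} = -1`, `a_{2n+1,j+1} = a_{2n-1,j}` and
`a_{2n+1,0} = ∑_{j=0}^{n-1} a_{2n-1,j} ω_{2j+1}`. -/
def acoef {A : Type} [Ring A] (ω : ℕ → A) : ℕ → ℕ → A
  | 0, _ => -1
  | n + 1, 0 => ∑ j ∈ Finset.range (n + 1), acoef ω n j * ω (2 * j + 1)
  | n + 1, j + 1 => acoef ω n j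

/-- The parameters `ω̄_k` determined by the parameters `ω` as in Corollary 3.5:
`ω̄_{2n} = 0` and `ω̄_{2n+1} = ∑_{j=0}^{n} a_{2n+1,j} ω_{2j+1}`. -/
def obar {R : Type} [CommRing R] (ω : ℕ → R) (k : ℕ) : R :=
  if k % 2 = 0 then 0
  else ∑ j ∈ Finset.range (k / 2 + 1), acoef ω (k / 2) j * ω (2 * j + 1)

/-- Data for the presentation of the walled Brauer–Clifford superalgebra `BC_{r,t}`
(Definition 2.1 together with relations (2.1)–(2.3)) on an `R`-algebra `A`.
The images of the two symmetric groups are recorded as monoid homomorphisms, so the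
symmetric group relations among the `s_i` (resp. `s̄_j`) hold automatically. -/
structure WBC (R A : Type) [CommRing R] [Ring A] [Algebra R A] (r t : ℕ) : Type where
  σ : Equiv.Perm (Fin r) →* A
  σb : Equiv.Perm (Fin t) →* A
  c : Fin r → A
  cb : Fin t → A
  e : A
  c_sq : ∀ i, c i * c i = -1
  c_anti : ∀ i j, i ≠ j → c i * c j = -(c j * c i)
  c_conj : ∀ w i, σ w * c i * σ (w⁻¹) = c (w i)
  cb_sq : ∀ i, cb i * cb i = 1
  cb_anti : ∀ i j, i ≠ j → cb i * cb j = -(cb j * cb i)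
  cb_conj : ∀ w i, σb w * cb i * σb (w⁻¹) = cb (w i)
  comm_σσb : ∀ w v, σ w * σb v = σb v * σ w
  comm_σcb : ∀ w j, σ w * cb j = cb j * σ w
  comm_σbc : ∀ v i, σb v * c i = c i * σb v
  anti_ccb : ∀ i j, c i * cb j = -(cb j * c i)
  e_c1 : ∀ (h1 : 0 < r) (h2 : 0 < t), e * c ⟨0, h1⟩ = e * cb ⟨0, h2⟩
  c1_e : ∀ (h1 : 0 < r) (h2 : 0 < t), c ⟨0, h1⟩ * e = cb ⟨0, h2⟩ * e
  e_sq : e * e = 0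
  e_s_e : 1 < r → e * σ (sw r 0 1) * e = e
  e_sb_e : 1 < t → e * σb (sw t 0 1) * e = e
  s_e_comm : ∀ i : ℕ, 0 < i → i + 1 < r → σ (sw r i (i + 1)) * e = e * σ (sw r i (i + 1))
  sb_e_comm : ∀ j : ℕ, 0 < j → j + 1 < t → σb (sw t j (j + 1)) * e = e * σb (sw t j (j + 1))
  braid1 : 1 < r → 1 < t →
    e * σ (sw r 0 1) * σb (sw t 0 1) * e * σ (sw r 0 1)
      = e * σ (sw r 0 1) * σb (sw t 0 1) * e * σb (sw t 0 1)
  braid2 : 1 < r → 1 < t →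
    σ (sw r 0 1) * e * σ (sw r 0 1) * σb (sw t 0 1) * e
      = σb (sw t 0 1) * e * σ (sw r 0 1) * σb (sw t 0 1) * e
  c_e_comm : ∀ i : Fin r, (i : ℕ) ≠ 0 → c i * e = e * c i
  cb_e_comm : ∀ j : Fin t, (j : ℕ) ≠ 0 → cb j * e = e * cb j
  e_c_e : ∀ h : 0 < r, e * c ⟨0, h⟩ * e = 0
  e_cb_e : ∀ h : 0 < t, e * cb ⟨0, h⟩ * e = 0

namespace WBC

variable {R A : Type} [CommRing R] [Ring A] [Algebra R A] {r t : ℕ}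

/-- The transposition `(i,j) ∈ Σ_r` (1-based indices). -/
def tr (d : WBC R A r t) (i j : ℕ) : A := d.σ (sw r (i - 1) (j - 1))

/-- The transposition `(ī,j̄) ∈ Σ_t` (1-based indices). -/
def trb (d : WBC R A r t) (i j : ℕ) : A := d.σb (sw t (i - 1) (j - 1))

/-- The generator `s_j = (j, j+1)` (1-based). -/
def s (d : WBC R A r t) (j : ℕ) : A := d.σ (sw r (j - 1) j)

/-- The generator `s̄_j` (1-based). -/
def sb (d : WBC R A r t) (j : ℕ) : A := d.σb (sw t (j - 1) j)

/-- The generator `c_i` (1-based). -/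
def cn (d : WBC R A r t) (i : ℕ) : A := if h : i - 1 < r then d.c ⟨i - 1, h⟩ else 0

/-- The generator `c̄_i` (1-based). -/
def cbn (d : WBC R A r t) (i : ℕ) : A := if h : i - 1 < t then d.cb ⟨i - 1, h⟩ else 0

/-- `e_{i,j} = (1̄,j̄)(1,i) e_1 (1,i)(1̄,j̄)` (1-based). -/
def E (d : WBC R A r t) (i j : ℕ) : A := d.trb 1 j * d.tr 1 i * d.e * d.tr 1 i * d.trb 1 j

/-- `ē_{i,j} = c_i e_{i,j} c_i`. -/
def Eb (d : WBC R A r t) (i j : ℕ) : A := d.cn i * d.E i j * d.cn i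

/-- `L'_i = ∑_{j=1}^{i-1} (j,i)`. -/
def LL (d : WBC R A r t) (i : ℕ) : A := ∑ j ∈ Finset.Ico 1 i, d.tr j i

/-- The Jucys–Murphy element `L_i = L'_i + c_i L'_i c_i`. -/
def L (d : WBC R A r t) (i : ℕ) : A := d.LL i + d.cn i * d.LL i * d.cn i

/-- `L̄'_i = ∑_{j=1}^{i-1} (j̄,ī)`. -/
def LLb (d : WBC R A r t) (i : ℕ) : A := ∑ j ∈ Finset.Ico 1 i, d.trb j i

/-- The Jucys–Murphy element `L̄_i = L̄'_i - c̄_i L̄'_i c̄_i`. -/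
def Lb (d : WBC R A r t) (i : ℕ) : A := d.LLb i - d.cbn i * d.LLb i * d.cbn i

/-- `y_i = ∑_{j=1}^{i-1} (e_{i,j} + ē_{i,j}) - L_i`. -/
def y (d : WBC R A r t) (i : ℕ) : A := (∑ j ∈ Finset.Ico 1 i, (d.E i j + d.Eb i j)) - d.L i

/-- `ȳ_i = ∑_{j=1}^{i-1} (e_{j,i} - ē_{j,i}) - L̄_i`. -/
def yb (d : WBC R A r t) (i : ℕ) : A := (∑ j ∈ Finset.Ico 1 i, (d.E j i - d.Eb j i)) - d.Lb i

/-- `c^α = c_1^{α_1} ⋯ c_r^{α_r}`. -/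
def cpow (d : WBC R A r t) (α : Fin r → Fin 2) : A :=
  ((List.finRange r).map (fun i => d.c i ^ (α i : ℕ))).prod

/-- `c̄^β = c̄_1^{β_1} ⋯ c̄_t^{β_t}`. -/
def cbpow (d : WBC R A r t) (β : Fin t → Fin 2) : A :=
  ((List.finRange t).map (fun j => d.cb j ^ (β j : ℕ))).prod

/-- `e^f = e_1 e_2 ⋯ e_f`. -/
def epow (d : WBC R A r t) (f : ℕ) : A :=
  ((List.range f).map (fun i => d.E (i + 1) (i + 1))).prod

/-- Generators of the subalgebra `BC_{m,m}`: the elements `e_1`, `s_1, …, s_{m-1}`,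
`s̄_1, …, s̄_{m-1}`, `c_1` and `c̄_1` (interpreted as `∅` when `m = 0`). -/
def lowerGens (d : WBC R A r t) (m : ℕ) : Set A :=
  {x | (1 ≤ m ∧ x = d.e) ∨ (∃ j : ℕ, 1 ≤ j ∧ j + 1 ≤ m ∧ x = d.s j)
    ∨ (∃ j : ℕ, 1 ≤ j ∧ j + 1 ≤ m ∧ x = d.sb j)
    ∨ (1 ≤ m ∧ x = d.cn 1) ∨ (1 ≤ m ∧ x = d.cbn 1)}

end WBC

/-- `φ` intertwines two sets of walled Brauer–Clifford data. -/
structure WBCHom {R A B : Type} [CommRing R] [Ring A] [Algebra R A] [Ring B] [Algebra R B]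
    {r t : ℕ} (d : WBC R A r t) (d' : WBC R B r t) (φ : A →ₐ[R] B) : Prop where
  map_σ : ∀ w, φ (d.σ w) = d'.σ w
  map_σb : ∀ w, φ (d.σb w) = d'.σb w
  map_c : ∀ i, φ (d.c i) = d'.c i
  map_cb : ∀ j, φ (d.cb j) = d'.cb j
  map_e : φ d.e = d'.e

/-- `A` (with the data `d`) *is* the walled Brauer–Clifford superalgebra `BC_{r,t}`:
it is initial among all algebras with such data. -/
def WBC.IsUniversal {R A : Type} [CommRing R] [Ring A] [Algebra R A] {r t : ℕ}
    (d : WBC R A r t) : Prop :=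
  ∀ (B : Type) [Ring B] [Algebra R B], ∀ d' : WBC R B r t, ∃! φ : A →ₐ[R] B, WBCHom d d' φ

/-- An element of `D^f_{r,t}`: data `1 ≤ i_1 < ⋯ < i_f ≤ r` and `k ≤ j_k ≤ t`
(all 1-based) describing `s_{f,i_f} s̄_{f,j_f} ⋯ s_{1,i_1} s̄_{1,j_1}`. -/
structure DElt (r t f : ℕ) : Type where
  a : Fin f → ℕ
  b : Fin f → ℕ
  ha_mono : StrictMono a
  ha_lb : ∀ k, 1 ≤ a k
  ha_ub : ∀ k, a k ≤ r
  hb_lb : ∀ k : Fin f, (k : ℕ) + 1 ≤ b k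
  hb_ub : ∀ k, b k ≤ t

/-- The `Σ_r`-component `s_{f,i_f} ⋯ s_{1,i_1}` of the element of `D^f_{r,t}`. -/
def DElt.pr {r t f : ℕ} (x : DElt r t f) : Equiv.Perm (Fin r) :=
  ((List.finRange f).reverse.map (fun (k : Fin f) => sIJ r ((k : ℕ) + 1) (x.a k))).prod

/-- The `Σ_t`-component `s̄_{f,j_f} ⋯ s̄_{1,j_1}` of the element of `D^f_{r,t}`. -/
def DElt.pt {r t f : ℕ} (x : DElt r t f) : Equiv.Perm (Fin t) :=
  ((List.finRange f).reverse.map (fun (k : Fin f) => sIJ t ((k : ℕ) + 1) (x.b k))).prod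

/-- Index for the basis `{c^α d_1⁻¹ e^f w d_2 c̄^β}` of `BC_{r,t}`; the component
`w ∈ Σ_{r-f} × Σ_{t-f}` is a pair of permutations fixing `1, …, f` pointwise. -/
structure BCIndex (r t : ℕ) : Type where
  α : Fin r → Fin 2
  β : Fin t → Fin 2
  f : ℕ
  hf : f ≤ min r t
  d1 : DElt r t f
  d2 : DElt r t f
  w : Equiv.Perm (Fin r)
  wb : Equiv.Perm (Fin t)
  hw : ∀ i : Fin r, (i : ℕ) < f → w i = i
  hwb : ∀ j : Fin t, (j : ℕ) < f → wb j = j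

/-- The basis element `c^α d_1⁻¹ e^f w d_2 c̄^β` of Theorem 2.4. -/
def WBC.basElt {R A : Type} [CommRing R] [Ring A] [Algebra R A] {r t : ℕ}
    (d : WBC R A r t) (x : BCIndex r t) : A :=
  d.cpow x.α * d.σ (x.d1.pr⁻¹) * d.σb (x.d1.pt⁻¹) * d.epow x.f *
    d.σ x.w * d.σb x.wb * d.σ x.d2.pr * d.σb x.d2.pt * d.cbpow x.β

/-- Data for the presentation of the affine walled Brauer–Clifford superalgebra
`BC^aff_{r,t}` (Definition 3.1) with distinguished parameter `ω_1 ∈ R`.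
`om k` is `ω_k` (with `ω_1` the scalar `ω1` and `ω_{2k} = 0`), `omb k` is `ω̄_k`. -/
structure AWBC (R A : Type) [CommRing R] [Ring A] [Algebra R A] (r t : ℕ) (ω1 : R)
    extends WBC R A r t : Type where
  x1 : A
  xb1 : A
  om : ℕ → A
  omb : ℕ → A
  om_one : om 1 = algebraMap R A ω1
  om_even : ∀ k, om (2 * k) = 0
  omb_zero : omb 0 = 0
  om_comm : ∀ k, (∀ w, om k * σ w = σ w * om k) ∧ (∀ w, om k * σb w = σb w * om k) ∧
    (∀ i, om k * c i = c i * om k) ∧ (∀ j, om k * cb j = cb j * om k) ∧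
    om k * e = e * om k ∧ om k * x1 = x1 * om k ∧ om k * xb1 = xb1 * om k ∧
    (∀ l, om k * om l = om l * om k) ∧ (∀ l, om k * omb l = omb l * om k)
  omb_comm : ∀ k, (∀ w, omb k * σ w = σ w * omb k) ∧ (∀ w, omb k * σb w = σb w * omb k) ∧
    (∀ i, omb k * c i = c i * omb k) ∧ (∀ j, omb k * cb j = cb j * omb k) ∧
    omb k * e = e * omb k ∧ omb k * x1 = x1 * omb k ∧ omb k * xb1 = xb1 * omb k ∧
    (∀ l, omb k * omb l = omb l * omb k)
  x_comm : ∀ h : 1 < r, x1 * (σ (sw r 0 1) * x1 * σ (sw r 0 1)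
      - (1 - c ⟨0, by omega⟩ * c ⟨1, h⟩) * σ (sw r 0 1))
    = (σ (sw r 0 1) * x1 * σ (sw r 0 1)
      - (1 - c ⟨0, by omega⟩ * c ⟨1, h⟩) * σ (sw r 0 1)) * x1
  x1_c1 : ∀ h : 0 < r, x1 * c ⟨0, h⟩ = -(c ⟨0, h⟩ * x1)
  x1_c : ∀ i : Fin r, (i : ℕ) ≠ 0 → x1 * c i = c i * x1
  s_x1 : ∀ i : ℕ, 0 < i → i + 1 < r → σ (sw r i (i + 1)) * x1 = x1 * σ (sw r i (i + 1))
  xb_comm : ∀ h : 1 < t, xb1 * (σb (sw t 0 1) * xb1 * σb (sw t 0 1)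
      - (1 + cb ⟨0, by omega⟩ * cb ⟨1, h⟩) * σb (sw t 0 1))
    = (σb (sw t 0 1) * xb1 * σb (sw t 0 1)
      - (1 + cb ⟨0, by omega⟩ * cb ⟨1, h⟩) * σb (sw t 0 1)) * xb1
  xb1_cb1 : ∀ h : 0 < t, xb1 * cb ⟨0, h⟩ = -(cb ⟨0, h⟩ * xb1)
  xb1_cb : ∀ j : Fin t, (j : ℕ) ≠ 0 → xb1 * cb j = cb j * xb1
  sb_xb1 : ∀ j : ℕ, 0 < j → j + 1 < t → σb (sw t j (j + 1)) * xb1 = xb1 * σb (sw t j (j + 1))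
  e_xsum : e * (x1 + xb1) = 0
  xsum_e : (x1 + xb1) * e = 0
  e_sxs : 1 < r → e * (σ (sw r 0 1) * x1 * σ (sw r 0 1)) = (σ (sw r 0 1) * x1 * σ (sw r 0 1)) * e
  x_mixed : ∀ h : 0 < r, x1 * (e + xb1 - c ⟨0, h⟩ * e * c ⟨0, h⟩)
      = (e - c ⟨0, h⟩ * e * c ⟨0, h⟩ + xb1) * x1
  e_sbxbsb : 1 < t →
    e * (σb (sw t 0 1) * xb1 * σb (sw t 0 1)) = (σb (sw t 0 1) * xb1 * σb (sw t 0 1)) * e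
  e_xodd : ∀ k : ℕ, e * x1 ^ (2 * k + 1) * e = om (2 * k + 1) * e
  e_xeven : ∀ k : ℕ, 1 ≤ k → e * x1 ^ (2 * k) * e = 0
  e_xb : ∀ k : ℕ, 1 ≤ k → e * xb1 ^ k * e = omb k * e
  x1_cb_comm : ∀ j, x1 * cb j = cb j * x1
  xb1_c_comm : ∀ i, xb1 * c i = c i * xb1
  x1_σb : ∀ w, σb w * x1 = x1 * σb w
  xb1_σ : ∀ w, σ w * xb1 = xb1 * σ w

namespace AWBC

variable {R A : Type} [CommRing R] [Ring A] [Algebra R A] {r t : ℕ} {ω1 : R}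

/-- `x'_i = s_{i-1} ⋯ s_1 x_1 s_1 ⋯ s_{i-1}` (1-based). -/
def xp (d : AWBC R A r t ω1) (i : ℕ) : A :=
  ((List.range (i - 1)).reverse.map (fun k => d.toWBC.s (k + 1))).prod * d.x1 *
    ((List.range (i - 1)).map (fun k => d.toWBC.s (k + 1))).prod

/-- `x̄'_j = s̄_{j-1} ⋯ s̄_1 x̄_1 s̄_1 ⋯ s̄_{j-1}` (1-based). -/
def xbp (d : AWBC R A r t ω1) (j : ℕ) : A :=
  ((List.range (j - 1)).reverse.map (fun k => d.toWBC.sb (k + 1))).prod * d.xb1 *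
    ((List.range (j - 1)).map (fun k => d.toWBC.sb (k + 1))).prod

/-- `x_i = x'_i - L_i`. -/
def xv (d : AWBC R A r t ω1) (i : ℕ) : A := d.xp i - d.toWBC.L i

/-- `x̄_j = x̄'_j - L̄_j`. -/
def xbv (d : AWBC R A r t ω1) (j : ℕ) : A := d.xbp j - d.toWBC.Lb j

/-- `x^α = x_1^{α_1} ⋯ x_r^{α_r}`. -/
def xpow (d : AWBC R A r t ω1) (α : Fin r → ℕ) : A :=
  ((List.finRange r).map (fun (i : Fin r) => d.xv ((i : ℕ) + 1) ^ α i)).prod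

/-- `x̄^β = x̄_1^{β_1} ⋯ x̄_t^{β_t}`. -/
def xbpow (d : AWBC R A r t ω1) (β : Fin t → ℕ) : A :=
  ((List.finRange t).map (fun (j : Fin t) => d.xbv ((j : ℕ) + 1) ^ β j)).prod

/-- `∏_{n ∈ ℤ^{>0}} ω_{2n+1}^{a_{2n+1}}`, where `g i` is the exponent of `ω_{2(i+1)+1}`. -/
def ompow (d : AWBC R A r t ω1) (g : ℕ →₀ ℕ) : A :=
  ((g.support.sort (· ≤ ·)).map (fun n => d.om (2 * n + 3) ^ g n)).prod

/-- `z_i = x'_i + y_i`. -/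
def z (d : AWBC R A r t ω1) (i : ℕ) : A := d.xp i + d.toWBC.y i

/-- `z̄_j = x̄'_j + ȳ_j`. -/
def zb (d : AWBC R A r t ω1) (j : ℕ) : A := d.xbp j + d.toWBC.yb j

/-- Generators of the subalgebra `BC_{2,m,m}`-type subalgebra:
`e_1, s_1, …, s_{m-1}, s̄_1, …, s̄_{m-1}, c_1, c̄_1, x_1, x̄_1`. -/
def lowerGensA (d : AWBC R A r t ω1) (m : ℕ) : Set A :=
  d.toWBC.lowerGens m ∪ {x | 1 ≤ m ∧ (x = d.x1 ∨ x = d.xb1)}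

end AWBC

/-- `φ` intertwines two sets of affine walled Brauer–Clifford data. -/
structure AWBCHom {R A B : Type} [CommRing R] [Ring A] [Algebra R A] [Ring B] [Algebra R B]
    {r t : ℕ} {ω1 : R} (d : AWBC R A r t ω1) (d' : AWBC R B r t ω1) (φ : A →ₐ[R] B) : Prop where
  map_σ : ∀ w, φ (d.σ w) = d'.σ w
  map_σb : ∀ w, φ (d.σb w) = d'.σb w
  map_c : ∀ i, φ (d.c i) = d'.c i
  map_cb : ∀ j, φ (d.cb j) = d'.cb j
  map_e : φ d.e = d'.e
  map_x1 : φ d.x1 = d'.x1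
  map_xb1 : φ d.xb1 = d'.xb1
  map_om : ∀ k, φ (d.om k) = d'.om k
  map_omb : ∀ k, φ (d.omb k) = d'.omb k

/-- `A` (with the data `d`) is the affine walled Brauer–Clifford superalgebra
`BC^aff_{r,t}` of Definition 3.1. -/
def AWBC.IsUniversal {R A : Type} [CommRing R] [Ring A] [Algebra R A] {r t : ℕ} {ω1 : R}
    (d : AWBC R A r t ω1) : Prop :=
  ∀ (B : Type) [Ring B] [Algebra R B], ∀ d' : AWBC R B r t ω1,
    ∃! φ : A →ₐ[R] B, AWBCHom d d' φ

/-- Assumption 3.6: the parameters `ω̄` are determined by the `ω`'s as in Corollary 3.5. -/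
def AWBC.Ass36 {R A : Type} [CommRing R] [Ring A] [Algebra R A] {r t : ℕ} {ω1 : R}
    (d : AWBC R A r t ω1) : Prop :=
  (∀ n, d.omb (2 * n) = 0) ∧
  (∀ n, d.omb (2 * n + 1) = ∑ j ∈ Finset.range (n + 1), acoef d.om n j * d.om (2 * j + 1))

/-- `A` (with the data `d`) is the affine walled Brauer–Clifford superalgebra
`BC^aff_{r,t}` subject to Assumption 3.6. -/
def AWBC.IsUniversal36 {R A : Type} [CommRing R] [Ring A] [Algebra R A] {r t : ℕ} {ω1 : R}
    (d : AWBC R A r t ω1) : Prop :=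
  d.Ass36 ∧ ∀ (B : Type) [Ring B] [Algebra R B], ∀ d' : AWBC R B r t ω1,
    d'.Ass36 → ∃! φ : A →ₐ[R] B, AWBCHom d d' φ

/-- The parameters `ω_k`, `ω̄_k` are the scalars `ω k`, `obar ω k` (specialization defining
the algebra `B̃C_{r,t}` of Definition 3.13). -/
def AWBC.IsSpec {R A : Type} [CommRing R] [Ring A] [Algebra R A] {r t : ℕ} {ω1 : R}
    (d : AWBC R A r t ω1) (ω : ℕ → R) : Prop :=
  (∀ k, d.om k = algebraMap R A (ω k)) ∧ (∀ k, 1 ≤ k → d.omb k = algebraMap R A (obar ω k))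

/-- `A` (with the data `d`) is the algebra `B̃C_{r,t}` of Definition 3.13 with parameters
`ω_{2n+1} ∈ R`. -/
def AWBC.IsSpecUniversal {R A : Type} [CommRing R] [Ring A] [Algebra R A] {r t : ℕ} {ω1 : R}
    (d : AWBC R A r t ω1) (ω : ℕ → R) : Prop :=
  d.IsSpec ω ∧ ∀ (B : Type) [Ring B] [Algebra R B], ∀ d' : AWBC R B r t ω1,
    d'.IsSpec ω → ∃! φ : A →ₐ[R] B, AWBCHom d d' φ

/-- The cyclotomic relations `f(x_1) = 0` and `g(x̄_1) = 0`. -/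
def AWBC.IsCyc {R A : Type} [CommRing R] [Ring A] [Algebra R A] {r t : ℕ} {ω1 : R}
    (d : AWBC R A r t ω1) (f g : Polynomial R) : Prop :=
  Polynomial.aeval d.x1 f = 0 ∧ Polynomial.aeval d.xb1 g = 0

/-- `A` (with the data `d`) is the cyclotomic walled Brauer–Clifford superalgebra
`BC_{ℓ,r,t}` of Definition 3.14 attached to `f`, `g` and the scalar parameters `ω`. -/
def AWBC.IsCycUniversal {R A : Type} [CommRing R] [Ring A] [Algebra R A] {r t : ℕ} {ω1 : R}
    (d : AWBC R A r t ω1) (ω : ℕ → R) (f g : Polynomial R) : Prop :=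
  d.IsSpec ω ∧ d.IsCyc f g ∧ ∀ (B : Type) [Ring B] [Algebra R B], ∀ d' : AWBC R B r t ω1,
    d'.IsSpec ω → d'.IsCyc f g → ∃! φ : A →ₐ[R] B, AWBCHom d d' φ

/-- Index of a regular monomial `x^α d x̄^β ∏_{n≥1} ω_{2n+1}^{a_{2n+1}}` of `BC^aff_{r,t}`. -/
structure ARIndex (r t : ℕ) : Type where
  α : Fin r → ℕ
  β : Fin t → ℕ
  dIdx : BCIndex r t
  g : ℕ →₀ ℕ

/-- The regular monomial `x^α d x̄^β ∏_{n≥1} ω_{2n+1}^{a_{2n+1}}` of Definition 3.11. -/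
def AWBC.regElt {R A : Type} [CommRing R] [Ring A] [Algebra R A] {r t : ℕ} {ω1 : R}
    (d : AWBC R A r t ω1) (x : ARIndex r t) : A :=
  d.xpow x.α * d.toWBC.basElt x.dIdx * d.xbpow x.β * d.ompow x.g

/-- Index of a regular monomial `x^α d x̄^β` of `B̃C_{r,t}`. -/
structure SIndex (r t : ℕ) : Type where
  α : Fin r → ℕ
  β : Fin t → ℕ
  dIdx : BCIndex r t

/-- The regular monomial `x^α d x̄^β` of `B̃C_{r,t}`. -/
def AWBC.sregElt {R A : Type} [CommRing R] [Ring A] [Algebra R A] {r t : ℕ} {ω1 : R}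
    (d : AWBC R A r t ω1) (x : SIndex r t) : A :=
  d.xpow x.α * d.toWBC.basElt x.dIdx * d.xbpow x.β

/-- Index of a regular monomial `x^α d x̄^β` of the level `ℓ` algebra `BC_{ℓ,r,t}`,
with exponents in `{0, 1, …, ℓ-1}`. -/
structure CIndex (r t ℓ : ℕ) : Type where
  α : Fin r → Fin ℓ
  β : Fin t → Fin ℓ
  dIdx : BCIndex r t

/-- The regular monomial `x^α d x̄^β` of `BC_{ℓ,r,t}`. -/
def AWBC.cregElt {R A : Type} [CommRing R] [Ring A] [Algebra R A] {r t ℓ : ℕ} {ω1 : R}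
    (d : AWBC R A r t ω1) (x : CIndex r t ℓ) : A :=
  d.xpow (fun i => (x.α i : ℕ)) * d.toWBC.basElt x.dIdx * d.xbpow (fun j => (x.β j : ℕ))

/-- Admissibility (Definition 6.4): writing `f(x) = x^{k+2m} + ∑_{i=1}^{2m} a_i x^{k+2m-i}`,
one has `ω_L = -(a_1 ω_{L-1} + ⋯ + a_{2m} ω_{L-2m})` for all `L ≥ k + 2m`. -/
def AdmissibleParam {R : Type} [CommRing R] (ω : ℕ → R) (f : Polynomial R) (k m : ℕ) : Prop :=
  ∀ L, k + 2 * m ≤ L →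
    ω L = -∑ i ∈ Finset.Icc 1 (2 * m), f.coeff (k + 2 * m - i) * ω (L - i)

/-- The parameters `ω_0 = 0`, `ω_1 = -2m(2p-2m+1)`, `ω_i = p(p+1) ω_{i-2}` of (4.16). -/
def omSeq (m : ℕ) (p : ℂ) : ℕ → ℂ
  | 0 => 0
  | 1 => -2 * (m : ℂ) * (2 * p - 2 * (m : ℂ) + 1)
  | n + 2 => p * (p + 1) * omSeq m p n

/-- Index of a monomial `d_1^{-1} c^α x'^β e^f x̄'^{β̄} c̄^{ᾱ} w d_2` of (4.20). -/
structure L2Index (r t : ℕ) : Type where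
  α : Fin r → Fin 2
  βx : Fin r → Fin 2
  αb : Fin t → Fin 2
  βxb : Fin t → Fin 2
  f : ℕ
  hf : f ≤ min r t
  d1 : DElt r t f
  d2 : DElt r t f
  w : Equiv.Perm (Fin r)
  wb : Equiv.Perm (Fin t)
  hw : ∀ i : Fin r, (i : ℕ) < f → w i = i
  hwb : ∀ j : Fin t, (j : ℕ) < f → wb j = j

/-- The monomial `d_1^{-1} c^α x'^β e^f x̄'^{β̄} c̄^{ᾱ} w d_2` of (4.20), where
`x'^β = x'_r{}^{β_r} ⋯ x'_1{}^{β_1}` and `x̄'^{β̄} = x̄'_t{}^{β̄_t} ⋯ x̄'_1{}^{β̄_1}`. -/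
def AWBC.l2Elt {R A : Type} [CommRing R] [Ring A] [Algebra R A] {r t : ℕ} {ω1 : R}
    (d : AWBC R A r t ω1) (x : L2Index r t) : A :=
  d.toWBC.σ (x.d1.pr⁻¹) * d.toWBC.σb (x.d1.pt⁻¹) * d.toWBC.cpow x.α *
    ((List.finRange r).reverse.map (fun (i : Fin r) => d.xp ((i : ℕ) + 1) ^ (x.βx i : ℕ))).prod *
    d.toWBC.epow x.f *
    ((List.finRange t).reverse.map (fun (j : Fin t) => d.xbp ((j : ℕ) + 1) ^ (x.βxb j : ℕ))).prod *
    d.toWBC.cbpow x.αb *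
    d.toWBC.σ x.w * d.toWBC.σb x.wb * d.toWBC.σ x.d2.pr * d.toWBC.σb x.d2.pt

set_option linter.unusedSimpArgs false
set_option linter.unusedVariables false
/-! ### Abstract ring computations -/

/-- The coefficients of Lemma 2.11. -/
def acoS4 {A : Type} [Ring A] (ω : ℕ → A) : ℕ → ℕ → A
  | 0, _ => -1
  | n + 1, 0 => ∑ j ∈ Finset.Ico 1 (n + 1), acoS4 ω n j * ω (2 * j + 1)
  | n + 1, j + 1 => acoS4 ω n j

theorem s4_main {R A : Type} [CommRing R] [Ring A] [Algebra R A] (h2 : IsUnit (2 : R))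
    (E Y Z c cb : A) (ω : ℕ → A)
    (hEE : E * E = 0) (hEcE : E * c * E = 0) (hcc : c * c = -1) (hbb : cb * cb = 1)
    (hEc : E * c = E * cb) (hcE : c * E = cb * E)
    (hYc : Y * c = -(c * Y)) (hYb : Y * cb = cb * Y) (hZc : Z * c = c * Z)
    (hEZ : E * Z = -(E * Y)) (hZE : Z * E = -(Y * E))
    (hcomm : Y * (Z + (E - c * E * c)) = (Z + (E - c * E * c)) * Y)
    (hEYE : E * Y * E = 0)
    (hω : ∀ a, E * Y ^ a * E = ω a * E) :
    ∃ a : ℕ → ℕ → A,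
      (∀ n j : ℕ, j ≤ n →
        a n j ∈ Algebra.adjoin R {x : A | ∃ l : ℕ, 1 ≤ l ∧ l + 1 ≤ n ∧ x = ω (2 * l + 1)}) ∧
      (∀ n : ℕ, E * Z ^ (2 * n + 1)
        = ∑ j ∈ Finset.range (n + 1), a n j * (E * Y ^ (2 * j + 1))) ∧
      (∀ n : ℕ, a n n = -1) ∧
      (∀ n j : ℕ, 1 ≤ j → j ≤ n → a n j = a (n - 1) (j - 1)) ∧
      (∀ n : ℕ, 1 ≤ n → a n 0 = ∑ j ∈ Finset.Ico 1 n, a (n - 1) j * ω (2 * j + 1)) := by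
  have two : ∀ x : A, x = -x → x = 0 := by
    intro x hx
    obtain ⟨u, hu⟩ := h2
    have h : (2 : R) • x = 0 := by
      rw [two_smul]; nth_rewrite 2 [hx]; simp
    have h' : (↑u⁻¹ * (2 : R)) • x = 0 := by rw [mul_smul, h, smul_zero]
    rw [← hu, Units.inv_mul, one_smul] at h'
    exact h'
  -- powers of Y
  have hYbp : ∀ m, Y ^ m * cb = cb * Y ^ m := fun m =>
    ((show Commute Y cb from hYb).pow_left m).eq
  have hY2c : Commute (Y ^ 2) c := by
    show Y ^ 2 * c = c * Y ^ 2
    rw [pow_two, mul_assoc, hYc, mul_neg, ← mul_assoc, hYc, neg_mul, neg_neg, mul_assoc]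
  have hYevc : ∀ k, Y ^ (2 * k) * c = c * Y ^ (2 * k) := fun k => by
    rw [pow_mul]; exact (hY2c.pow_left k).eq
  -- even moments vanish
  have hp : ∀ k, E * Y ^ (2 * k) * E = 0 := by
    intro k
    apply two
    have h1 : E * Y ^ (2 * k) * E = -(E * Y ^ (2 * k) * (c * (c * E))) := by
      rw [← mul_assoc c, hcc]; simp
    have h3 : E * Y ^ (2 * k) * (c * (c * E)) = E * Y ^ (2 * k) * E := by
      calc E * Y ^ (2 * k) * (c * (c * E)) = E * (Y ^ (2 * k) * c) * (cb * E) := by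
            rw [hcE]; noncomm_ring
        _ = E * c * Y ^ (2 * k) * (cb * E) := by rw [hYevc]; noncomm_ring
        _ = E * (cb * Y ^ (2 * k)) * (cb * E) := by rw [hEc]; noncomm_ring
        _ = E * Y ^ (2 * k) * (cb * cb) * E := by rw [← hYbp]; noncomm_ring
        _ = _ := by rw [hbb]; noncomm_ring
    nth_rewrite 1 [h1]
    rw [h3]
  -- moving Z through powers of Y
  have hcommp : ∀ m, Y ^ m * (Z + (E - c * E * c)) = (Z + (E - c * E * c)) * Y ^ m := fun m =>
    ((show Commute Y _ from hcomm).pow_left m).eq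
  have hEu : E * (E - c * E * c) = 0 := by
    have : E * (E - c * E * c) = E * E - E * c * E * c := by noncomm_ring
    rw [this, hEE, hEcE]; simp
  have key : ∀ m, E * Y ^ m * Z = -(E * Y ^ (m + 1)) - E * Y ^ m * E + E * Y ^ m * c * E * c := by
    intro m
    have h : E * (Y ^ m * (Z + (E - c * E * c))) = E * ((Z + (E - c * E * c)) * Y ^ m) := by
      rw [hcommp m]
    have h' : E * ((Z + (E - c * E * c)) * Y ^ m) = E * Z * Y ^ m + E * (E - c * E * c) * Y ^ m := by
      noncomm_ring
    rw [h', hEu, hEZ] at h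
    have h3 : E * (Y ^ m * (Z + (E - c * E * c)))
        = E * Y ^ m * Z + E * Y ^ m * E - E * Y ^ m * c * E * c := by
      simp only [mul_add, mul_sub, mul_assoc]; abel
    rw [h3] at h
    have h4 : E * Y ^ m * Z = (E * Y ^ m * Z + E * Y ^ m * E - E * Y ^ m * c * E * c)
        - E * Y ^ m * E + E * Y ^ m * c * E * c := by abel
    rw [h4, h, pow_succ']
    simp only [mul_assoc, neg_mul, zero_mul, add_zero]
  have hq : ∀ m, E * Y ^ m * c * E = 0 := by
    intro m
    rcases m with _ | m
    · simpa using hEcE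
    apply two
    have h : E * Y ^ m * Z * (c * E) = (-(E * Y ^ (m + 1)) - E * Y ^ m * E
        + E * Y ^ m * c * E * c) * (c * E) := by rw [key m]
    have hl : E * Y ^ m * Z * (c * E) = E * Y ^ (m + 1) * c * E := by
      calc E * Y ^ m * Z * (c * E) = E * Y ^ m * (Z * c) * E := by noncomm_ring
        _ = E * Y ^ m * c * (Z * E) := by rw [hZc]; noncomm_ring
        _ = E * Y ^ m * (-(c * Y)) * E := by rw [hZE]; noncomm_ring
        _ = _ := by rw [← hYc, pow_succ]; noncomm_ring
    have hr' : (-(E * Y ^ (m + 1)) - E * Y ^ m * E + E * Y ^ m * c * E * c) * (c * E)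
        = -(E * Y ^ (m + 1) * c * E) - E * Y ^ m * (E * c * E)
          + E * Y ^ m * c * (E * (c * c) * E) := by
      simp only [mul_assoc, add_mul, sub_mul, neg_mul]
    rw [hl, hr', hEcE, hcc, mul_neg, mul_one, neg_mul, hEE] at h
    simpa using h
  have key' : ∀ m, E * Y ^ m * Z = -(E * Y ^ (m + 1)) - ω m * E := by
    intro m; rw [key, hq, hω]; simp
  have step : ∀ j, E * Y ^ (2 * j + 1) * Z ^ 2
      = E * Y ^ (2 * (j + 1) + 1) + ω (2 * j + 1) * (E * Y) := by
    intro j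
    rw [pow_two, ← mul_assoc, key', sub_mul, neg_mul,
      show 2 * j + 1 + 1 = 2 * (j + 1) by ring, key', ← hω, hp, mul_assoc, hEZ]
    simp
  have hω1 : ω 1 * E = 0 := by rw [← hω, pow_one, hEYE]
  refine ⟨acoS4 ω, ?_, ?_, ?_, ?_, ?_⟩
  · intro n
    induction n with
    | zero => intro j _; simp only [acoS4]; exact neg_mem (one_mem _)
    | succ n ih =>
      have hmono : Algebra.adjoin R {x : A | ∃ l : ℕ, 1 ≤ l ∧ l + 1 ≤ n ∧ x = ω (2 * l + 1)} ≤
          Algebra.adjoin R {x : A | ∃ l : ℕ, 1 ≤ l ∧ l + 1 ≤ n + 1 ∧ x = ω (2 * l + 1)} := by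
        apply Algebra.adjoin_mono
        rintro x ⟨l, h1, h2, h3⟩
        exact ⟨l, h1, by omega, h3⟩
      intro j hj
      rcases j with _ | j
      · simp only [acoS4]
        refine sum_mem fun j hj => ?_
        rw [Finset.mem_Ico] at hj
        exact mul_mem (hmono (ih j (by omega)))
          (Algebra.subset_adjoin ⟨j, hj.1, by omega, rfl⟩)
      · simp only [acoS4]
        exact hmono (ih j (by omega))
  · intro n
    induction n with
    | zero => simp [acoS4, hEZ]
    | succ n ih =>
      have h0 : ω (2 * 0 + 1) * (E * Y) = 0 := by
        rw [← mul_assoc]; simp [hω1]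
      rw [show 2 * (n + 1) + 1 = (2 * n + 1) + 2 by ring, pow_add, ← mul_assoc, ih,
        Finset.sum_mul, Finset.sum_range_succ' _ (n + 1)]
      simp only [acoS4, mul_assoc]
      have : ∀ j, E * (Y ^ (2 * j + 1) * Z ^ 2)
          = E * Y ^ (2 * (j + 1) + 1) + ω (2 * j + 1) * (E * Y) := by
        intro j; rw [← step, mul_assoc]
      simp only [this, mul_add, Finset.sum_add_distrib]
      congr 1
      rw [Finset.range_eq_Ico, Finset.sum_eq_sum_Ico_succ_bot (by omega), h0]
      simp [Finset.sum_mul, mul_assoc]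
  · intro n
    induction n with
    | zero => rfl
    | succ n ih => simpa [acoS4] using ih
  · intro n j hj hjn
    obtain ⟨j, rfl⟩ : ∃ k, j = k + 1 := ⟨j - 1, by omega⟩
    obtain ⟨n, rfl⟩ : ∃ k, n = k + 1 := ⟨n - 1, by omega⟩
    simp [acoS4]
  · intro n hn
    obtain ⟨n, rfl⟩ : ∃ k, n = k + 1 := ⟨n - 1, by omega⟩
    simp [acoS4]

/-- Assoc version of a word identity. -/
theorem s4_assoc {A : Type} [Ring A] {a b e : A} (h : a * b = e) (x : A) :
    a * (b * x) = e * x := by rw [← mul_assoc, h]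

theorem s4_assoc3 {A : Type} [Ring A] {a b f e : A} (h : a * (b * f) = e) (x : A) :
    a * (b * (f * x)) = e * x := by rw [← h]; simp only [mul_assoc]

theorem s4_assoc4 {A : Type} [Ring A] {a b f g e : A} (h : a * (b * (f * g)) = e) (x : A) :
    a * (b * (f * (g * x))) = e * x := by rw [← h]; simp only [mul_assoc]

theorem s4_XS {A : Type} [Ring A] (E s c b f : A)
    (hEE : E * E = 0) (hEcE : E * c * E = 0) (hcc : c * c = -1) (hbb : b * b = 1) (hff : f * f = 1)
    (hEc : E * c = E * b) (hcE : c * E = b * E) (hfE : E * f = f * E)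
    (hss : s * s = 1) (hEsE : E * s * E = E)
    (hsb : s * b = f * s) (hsf : s * f = b * s) (hsc : s * c = c * s)
    (hbc : b * c = -(c * b)) (hcf : c * f = -(f * c)) (hbf : b * f = -(f * b)) :
    (s * E * s + c * (s * E * s) * c) * (E - c * E * c)
      = (s * E * s + c * (s * E * s) * c) * (s - b * s * b) ∧
    (E - c * E * c) * (s * E * s + c * (s * E * s) * c)
      = (s - b * s * b) * (s * E * s + c * (s * E * s) * c) ∧
    E * (s * E * s + c * (s * E * s) * c) = E * (s - b * s * b) ∧
    (s * E * s + c * (s * E * s) * c) * E = (s - b * s * b) * E ∧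
    E * (s - b * s * b) * E = E + E := by
  have hbE := hcE.symm
  have hEbE : E * (b * E) = 0 := by rw [← hcE, ← mul_assoc, hEcE]
  rw [mul_assoc] at hEsE
  have h1 : E * (b * (s * E)) = f * E := by
    calc E * (b * (s * E)) = E * (s * f * E) := by rw [hsf, mul_assoc]
      _ = (E * (s * E)) * f := by rw [mul_assoc s, ← hfE]; simp only [mul_assoc]
      _ = _ := by rw [hEsE, hfE]
  have h2 : f * (b * (s * E)) = c * (b * (s * E)) := by
    have h3 : f * (s * E) = c * (s * E) := by
      rw [← mul_assoc, ← hsb, mul_assoc, hbE, ← mul_assoc, hsc, mul_assoc]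
    have h4 : f * b = -(b * f) := by rw [hbf, neg_neg]
    have h5 : c * b = -(b * c) := by rw [hbc, neg_neg]
    rw [← mul_assoc f, h4, neg_mul, mul_assoc, h3, ← mul_assoc c b, h5, neg_mul, mul_assoc]
  refine ⟨?_, ?_, ?_, ?_, ?_⟩ <;>
  · simp only [mul_add, add_mul, mul_sub, sub_mul, mul_assoc, mul_neg, neg_mul, mul_one, one_mul,
      neg_neg, mul_zero, zero_mul, neg_zero,
      hEE, hcc, hbb, hff, hEc, hbE, hfE, hss, hsb, hsf, hsc, hbc, hcf, hbf, hEbE, hEsE, h1, h2,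
      s4_assoc hEE, s4_assoc hcc, s4_assoc hbb, s4_assoc hff, s4_assoc hEc, s4_assoc hbE,
      s4_assoc hfE, s4_assoc hss, s4_assoc hsb, s4_assoc hsf, s4_assoc hsc, s4_assoc hbc,
      s4_assoc hcf, s4_assoc hbf, s4_assoc3 hEbE, s4_assoc3 hEsE, s4_assoc4 h1]
    try abel

theorem s4_ZT {A : Type} [Ring A] (E s c f : A)
    (hEE : E * E = 0) (hEcE : E * c * E = 0) (hcc : c * c = -1) (hff : f * f = -1)
    (hfE : E * f = f * E)
    (hss : s * s = 1) (hEsE : E * s * E = E)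
    (hsc : s * c = f * s) (hsf : s * f = c * s)
    (hcf : c * f = -(f * c)) :
    E * (s * E * s - f * (s * E * s) * f) = E * (s + c * s * c) ∧
    (s * E * s - f * (s * E * s) * f) * E = (s + c * s * c) * E ∧
    E * (s + c * s * c) * E = E + E ∧
    (s + c * s * c) * ((s * E * s - f * (s * E * s) * f) + (E - c * E * c))
     = ((s * E * s - f * (s * E * s) * f) + (E - c * E * c)) * (s + c * s * c) := by
  rw [mul_assoc] at hEsE hEcE
  have h1 : E * (c * (s * E)) = f * E := by
    calc E * (c * (s * E)) = E * (s * f * E) := by rw [hsf, mul_assoc]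
      _ = (E * (s * E)) * f := by rw [mul_assoc s, ← hfE]; simp only [mul_assoc]
      _ = _ := by rw [hEsE, hfE]
  refine ⟨?_, ?_, ?_, ?_⟩ <;>
  · simp only [mul_add, add_mul, mul_sub, sub_mul, mul_assoc, mul_neg, neg_mul, mul_one, one_mul,
      neg_neg, mul_zero, zero_mul, neg_zero,
      hEE, hcc, hff, hfE, hss, hsc, hsf, hcf, hEcE, hEsE, h1,
      s4_assoc hEE, s4_assoc hcc, s4_assoc hff, 
      s4_assoc hfE, s4_assoc hss, s4_assoc hsf, s4_assoc hsc, 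
      s4_assoc hcf, s4_assoc3 hEcE, s4_assoc3 hEsE, s4_assoc4 h1]
    try abel

/-! ### Relations in the walled Brauer–Clifford superalgebra -/

theorem s4_sw (n a b : ℕ) (ha : a < n) (hb : b < n) :
    sw n a b = Equiv.swap ⟨a, ha⟩ ⟨b, hb⟩ := by
  simp [sw, ha, hb]

theorem s4_exists_perm {n : ℕ} {x y u v : Fin n} (hxy : x ≠ y) (huv : u ≠ v) :
    ∃ w : Equiv.Perm (Fin n), w x = u ∧ w y = v := by
  refine ⟨Equiv.swap x u * Equiv.swap y (Equiv.swap x u v), ?_, ?_⟩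
  · have h : x ≠ Equiv.swap x u v := by
      intro h
      have := congrArg (Equiv.swap x u) h
      simp at this
      exact huv this
    simp [Equiv.swap_apply_of_ne_of_ne hxy h]
  · simp

/-- An element commuting with the images of all adjacent transpositions not involving `0`
commutes with the images of all permutations fixing `0`. -/
theorem s4_stab {A : Type} [Ring A] {n : ℕ} (σ : Equiv.Perm (Fin (n + 1)) →* A) (e : A)
    (h : ∀ i : ℕ, 0 < i → i + 1 < n + 1 →
      σ (sw (n + 1) i (i + 1)) * e = e * σ (sw (n + 1) i (i + 1)))
    (w : Equiv.Perm (Fin (n + 1))) (hw : w 0 = 0) : σ w * e = e * σ w := by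
  -- transpositions
  have h1 : ∀ k a : ℕ, ∀ (ha : 0 < a) (hk : a + k < n + 1),
      Commute (σ (Equiv.swap ⟨a, by omega⟩ ⟨a + k, hk⟩)) e := by
    intro k
    induction k with
    | zero =>
      intro a ha hk
      simp only [Nat.add_zero, Equiv.swap_self]
      rw [← Equiv.Perm.one_def, map_one]
      exact Commute.one_left e
    | succ k ih =>
      intro a ha hk
      have h2 := ih a ha (by omega)
      have h3 : Commute (σ (Equiv.swap ⟨a + k, by omega⟩ ⟨a + (k + 1), hk⟩)) e := by
        have := h (a + k) (by omega) (by omega)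
        rw [s4_sw _ _ _ (by omega) (by omega)] at this
        exact this
      rcases Nat.eq_zero_or_pos k with rfl | hk0
      · simpa using h3
      have h4 : Equiv.swap (⟨a, by omega⟩ : Fin (n + 1)) ⟨a + (k + 1), hk⟩
          = Equiv.swap ⟨a + k, by omega⟩ ⟨a + (k + 1), hk⟩ *
            Equiv.swap ⟨a, by omega⟩ ⟨a + k, by omega⟩ *
            Equiv.swap ⟨a + k, by omega⟩ ⟨a + (k + 1), hk⟩ := by
        rw [Equiv.swap_mul_swap_mul_swap]
        · exact Equiv.swap_comm _ _
        · simp [Fin.ext_iff]; omega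
        · simp [Fin.ext_iff]
      rw [h4, map_mul, map_mul]
      exact (h3.mul_left h2).mul_left h3
  have h2 : ∀ a b : Fin (n + 1), a ≠ 0 → b ≠ 0 → Commute (σ (Equiv.swap a b)) e := by
    have h3 : ∀ a b : Fin (n + 1), a ≠ 0 → a ≤ b → Commute (σ (Equiv.swap a b)) e := by
      intro a b ha hab
      have ha' : 0 < a.val := Nat.pos_of_ne_zero (fun h => ha (Fin.ext h))
      have hab' : a.val ≤ b.val := hab
      have := h1 (b.val - a.val) a.val ha' (by have := b.2; omega)
      convert this using 4
      omega
    intro a b ha hb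
    rcases le_total a b with hab | hab
    · exact h3 a b ha hab
    · rw [Equiv.swap_comm]; exact h3 b a hb hab
  have h3 : ∀ v : Equiv.Perm {x : Fin (n + 1) // x ≠ 0},
      Commute (σ (Equiv.Perm.ofSubtype v)) e := by
    intro v
    induction v using Equiv.Perm.swap_induction_on with
    | one => simp
    | swap_mul f x y hxy ih =>
      rw [map_mul, map_mul, Equiv.Perm.ofSubtype_swap_eq]
      exact (h2 x y x.2 y.2).mul_left ih
  have h4 : ∀ x : Fin (n + 1), w x ≠ 0 ↔ x ≠ 0 := by
    intro x
    rw [not_iff_not]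
    constructor
    · intro hx; exact w.injective (hx.trans hw.symm)
    · rintro rfl; exact hw
  have h5 := h3 (w.subtypePerm h4)
  rw [Equiv.Perm.ofSubtype_subtypePerm] at h5
  · exact h5
  · intro x hx hx0
    subst hx0
    exact hx hw

namespace WBC

variable {R A : Type} [CommRing R] [Ring A] [Algebra R A] {r t : ℕ}

/-- `e_{a,b}` with `Fin` indices. -/
def F (d : WBC R A (r + 1) (t + 1)) (a : Fin (r + 1)) (b : Fin (t + 1)) : A :=
  d.σb (Equiv.swap 0 b) * d.σ (Equiv.swap 0 a) * d.e * d.σ (Equiv.swap 0 a) *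
    d.σb (Equiv.swap 0 b)

variable (d : WBC R A (r + 1) (t + 1))

theorem F_zero : d.F 0 0 = d.e := by
  simp only [F, Equiv.swap_self, ← Equiv.Perm.one_def, map_one, one_mul, mul_one]

theorem σ_swap_sq {r t : ℕ} (d : WBC R A r t) (a b : Fin r) :
    d.σ (Equiv.swap a b) * d.σ (Equiv.swap a b) = 1 := by
  rw [← map_mul, Equiv.swap_mul_self, map_one]

theorem σb_swap_sq {r t : ℕ} (d : WBC R A r t) (a b : Fin t) :
    d.σb (Equiv.swap a b) * d.σb (Equiv.swap a b) = 1 := by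
  rw [← map_mul, Equiv.swap_mul_self, map_one]

theorem σ_inv {r t : ℕ} (d : WBC R A r t) (w : Equiv.Perm (Fin r)) : d.σ w⁻¹ * d.σ w = 1 := by
  rw [← map_mul, inv_mul_cancel, map_one]

theorem σb_inv {r t : ℕ} (d : WBC R A r t) (w : Equiv.Perm (Fin t)) : d.σb w⁻¹ * d.σb w = 1 := by
  rw [← map_mul, inv_mul_cancel, map_one]

theorem σ_c {r t : ℕ} (d : WBC R A r t) (w : Equiv.Perm (Fin r)) (i) :
    d.σ w * d.c i = d.c (w i) * d.σ w := by
  rw [← d.c_conj, mul_assoc, σ_inv, mul_one]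

theorem σb_cb {r t : ℕ} (d : WBC R A r t) (w : Equiv.Perm (Fin t)) (i) :
    d.σb w * d.cb i = d.cb (w i) * d.σb w := by
  rw [← d.cb_conj, mul_assoc, σb_inv, mul_one]

/-- conjugation of `e_{a,b}` by permutations -/
theorem σ_F (w : Equiv.Perm (Fin (r + 1))) (a : Fin (r + 1)) (b : Fin (t + 1)) :
    d.σ w * d.F a b = d.F (w a) b * d.σ w := by
  have hv := s4_stab d.σ d.e d.s_e_comm (Equiv.swap 0 (w a) * w * Equiv.swap 0 a) (by simp)
  have h1 : d.σ w * d.σ (Equiv.swap 0 a)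
      = d.σ (Equiv.swap 0 (w a)) * d.σ (Equiv.swap 0 (w a) * w * Equiv.swap 0 a) := by
    simp only [← map_mul, ← mul_assoc, Equiv.swap_mul_self, one_mul]
  have h2 : d.σ (Equiv.swap 0 (w a) * w * Equiv.swap 0 a) * d.σ (Equiv.swap 0 a)
      = d.σ (Equiv.swap 0 (w a)) * d.σ w := by
    simp only [← map_mul, mul_assoc, Equiv.swap_mul_self, mul_one]
  unfold F
  calc d.σ w * (d.σb (Equiv.swap 0 b) * d.σ (Equiv.swap 0 a) * d.e * d.σ (Equiv.swap 0 a) *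
        d.σb (Equiv.swap 0 b))
      = (d.σ w * d.σb (Equiv.swap 0 b)) * d.σ (Equiv.swap 0 a) * d.e * d.σ (Equiv.swap 0 a) *
        d.σb (Equiv.swap 0 b) := by simp only [mul_assoc]
    _ = d.σb (Equiv.swap 0 b) * (d.σ w * d.σ (Equiv.swap 0 a)) * d.e * d.σ (Equiv.swap 0 a) *
        d.σb (Equiv.swap 0 b) := by rw [d.comm_σσb]; simp only [mul_assoc]
    _ = d.σb (Equiv.swap 0 b) * d.σ (Equiv.swap 0 (w a)) *
        (d.σ (Equiv.swap 0 (w a) * w * Equiv.swap 0 a) * d.e) * d.σ (Equiv.swap 0 a) *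
        d.σb (Equiv.swap 0 b) := by rw [h1]; simp only [mul_assoc]
    _ = d.σb (Equiv.swap 0 b) * d.σ (Equiv.swap 0 (w a)) * d.e *
        (d.σ (Equiv.swap 0 (w a) * w * Equiv.swap 0 a) * d.σ (Equiv.swap 0 a)) *
        d.σb (Equiv.swap 0 b) := by rw [hv]; simp only [mul_assoc]
    _ = d.σb (Equiv.swap 0 b) * d.σ (Equiv.swap 0 (w a)) * d.e *
        d.σ (Equiv.swap 0 (w a)) * (d.σ w * d.σb (Equiv.swap 0 b)) := by
          rw [h2]; simp only [mul_assoc]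
    _ = _ := by rw [d.comm_σσb]; simp only [mul_assoc]

theorem F_alt (a : Fin (r + 1)) (b : Fin (t + 1)) :
    d.F a b = d.σ (Equiv.swap 0 a) * d.σb (Equiv.swap 0 b) * d.e * d.σb (Equiv.swap 0 b) *
      d.σ (Equiv.swap 0 a) := by
  unfold F
  rw [d.comm_σσb, mul_assoc _ (d.σ _) (d.σb _), d.comm_σσb]
  simp only [mul_assoc]

theorem σb_F (w : Equiv.Perm (Fin (t + 1))) (a : Fin (r + 1)) (b : Fin (t + 1)) :
    d.σb w * d.F a b = d.F a (w b) * d.σb w := by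
  have hv := s4_stab d.σb d.e d.sb_e_comm (Equiv.swap 0 (w b) * w * Equiv.swap 0 b) (by simp)
  have h1 : d.σb w * d.σb (Equiv.swap 0 b)
      = d.σb (Equiv.swap 0 (w b)) * d.σb (Equiv.swap 0 (w b) * w * Equiv.swap 0 b) := by
    simp only [← map_mul, ← mul_assoc, Equiv.swap_mul_self, one_mul]
  have h2 : d.σb (Equiv.swap 0 (w b) * w * Equiv.swap 0 b) * d.σb (Equiv.swap 0 b)
      = d.σb (Equiv.swap 0 (w b)) * d.σb w := by
    simp only [← map_mul, mul_assoc, Equiv.swap_mul_self, mul_one]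
  rw [F_alt, F_alt]
  calc d.σb w * (d.σ (Equiv.swap 0 a) * d.σb (Equiv.swap 0 b) * d.e * d.σb (Equiv.swap 0 b) *
        d.σ (Equiv.swap 0 a))
      = (d.σb w * d.σ (Equiv.swap 0 a)) * d.σb (Equiv.swap 0 b) * d.e * d.σb (Equiv.swap 0 b) *
        d.σ (Equiv.swap 0 a) := by simp only [mul_assoc]
    _ = d.σ (Equiv.swap 0 a) * (d.σb w * d.σb (Equiv.swap 0 b)) * d.e * d.σb (Equiv.swap 0 b) *
        d.σ (Equiv.swap 0 a) := by rw [← d.comm_σσb]; simp only [mul_assoc]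
    _ = d.σ (Equiv.swap 0 a) * d.σb (Equiv.swap 0 (w b)) *
        (d.σb (Equiv.swap 0 (w b) * w * Equiv.swap 0 b) * d.e) * d.σb (Equiv.swap 0 b) *
        d.σ (Equiv.swap 0 a) := by rw [h1]; simp only [mul_assoc]
    _ = d.σ (Equiv.swap 0 a) * d.σb (Equiv.swap 0 (w b)) * d.e *
        (d.σb (Equiv.swap 0 (w b) * w * Equiv.swap 0 b) * d.σb (Equiv.swap 0 b)) *
        d.σ (Equiv.swap 0 a) := by rw [hv]; simp only [mul_assoc]
    _ = d.σ (Equiv.swap 0 a) * d.σb (Equiv.swap 0 (w b)) * d.e *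
        d.σb (Equiv.swap 0 (w b)) * (d.σb w * d.σ (Equiv.swap 0 a)) := by
          rw [h2]; simp only [mul_assoc]
    _ = _ := by rw [← d.comm_σσb]; simp only [mul_assoc]

/-- Conjugation by a pair of permutations, as a ring homomorphism. -/
def cj (w : Equiv.Perm (Fin (r + 1))) (v : Equiv.Perm (Fin (t + 1))) : A →+* A where
  toFun x := d.σ w * d.σb v * x * (d.σb v⁻¹ * d.σ w⁻¹)
  map_one' := by
    rw [mul_one, mul_assoc, ← mul_assoc (d.σb v), ← map_mul d.σb, mul_inv_cancel, map_one,
      one_mul, ← map_mul, mul_inv_cancel, map_one]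
  map_mul' x y := by
    have h : d.σb v⁻¹ * d.σ w⁻¹ * (d.σ w * d.σb v) = 1 := by
      rw [mul_assoc, ← mul_assoc (d.σ w⁻¹), σ_inv, one_mul, σb_inv]
    have : d.σ w * d.σb v * x * (d.σb v⁻¹ * d.σ w⁻¹) * (d.σ w * d.σb v * y *
        (d.σb v⁻¹ * d.σ w⁻¹)) = d.σ w * d.σb v * x * (d.σb v⁻¹ * d.σ w⁻¹ * (d.σ w * d.σb v)) * y *
        (d.σb v⁻¹ * d.σ w⁻¹) := by simp only [mul_assoc]
    rw [this, h]
    simp only [mul_assoc, one_mul]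
  map_zero' := by simp
  map_add' x y := by simp only [mul_add, add_mul]

theorem cj_of (w v) {x y : A} (h : d.σ w * d.σb v * x = y * (d.σ w * d.σb v)) :
    d.cj w v x = y := by
  show d.σ w * d.σb v * x * (d.σb v⁻¹ * d.σ w⁻¹) = y
  rw [h]
  have : y * (d.σ w * d.σb v) * (d.σb v⁻¹ * d.σ w⁻¹)
    = y * (d.σ w * (d.σb v * d.σb v⁻¹) * d.σ w⁻¹) := by simp only [mul_assoc]
  rw [this, ← map_mul d.σb, mul_inv_cancel, map_one, mul_one, ← map_mul, mul_inv_cancel,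
    map_one, mul_one]

theorem cj_F (w v a b) : d.cj w v (d.F a b) = d.F (w a) (v b) := by
  apply cj_of
  rw [mul_assoc, σb_F, ← mul_assoc, σ_F, mul_assoc]

theorem cj_c (w v a) : d.cj w v (d.c a) = d.c (w a) := by
  apply cj_of
  rw [mul_assoc, d.comm_σbc, ← mul_assoc, σ_c, mul_assoc]

theorem cj_cb (w v b) : d.cj w v (d.cb b) = d.cb (v b) := by
  apply cj_of
  rw [mul_assoc, σb_cb, ← mul_assoc, d.comm_σcb, mul_assoc]

theorem cj_σ (w v u) : d.cj w v (d.σ u) = d.σ (w * u * w⁻¹) := by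
  apply cj_of
  rw [mul_assoc, ← d.comm_σσb, ← mul_assoc, ← mul_assoc, ← map_mul, ← map_mul]
  simp

theorem cj_σb (w v u) : d.cj w v (d.σb u) = d.σb (v * u * v⁻¹) := by
  apply cj_of
  rw [mul_assoc, d.comm_σσb, ← mul_assoc (d.σb (v * u * v⁻¹)), ← map_mul, ← map_mul, 
    d.comm_σσb]
  simp

theorem cj_swap (w v x y) : d.cj w v (d.σ (Equiv.swap x y)) = d.σ (Equiv.swap (w x) (w y)) := by
  rw [cj_σ, Equiv.swap_apply_apply]

theorem cj_swapb (w v x y) : d.cj w v (d.σb (Equiv.swap x y)) = d.σb (Equiv.swap (v x) (v y)) := by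
  rw [cj_σb, Equiv.swap_apply_apply]

theorem F_sq (a b) : d.F a b * d.F a b = 0 := by
  have := congrArg (d.cj (Equiv.swap 0 a) (Equiv.swap 0 b)) d.e_sq
  rw [← F_zero, map_mul, cj_F, (d.cj _ _).map_zero] at this
  simpa using this

theorem F_c_F (a b) : d.F a b * d.c a * d.F a b = 0 := by
  have := congrArg (d.cj (Equiv.swap 0 a) (Equiv.swap 0 b)) (d.e_c_e (Nat.succ_pos _))
  rw [← F_zero, map_mul, map_mul, cj_F, cj_c, (d.cj _ _).map_zero] at this
  simpa using this

theorem F_c (a b) : d.F a b * d.c a = d.F a b * d.cb b := by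
  have := congrArg (d.cj (Equiv.swap 0 a) (Equiv.swap 0 b))
    (d.e_c1 (Nat.succ_pos _) (Nat.succ_pos _))
  rw [← F_zero, map_mul, map_mul, cj_F, cj_c, cj_cb] at this
  simpa using this

theorem c_F (a b) : d.c a * d.F a b = d.cb b * d.F a b := by
  have := congrArg (d.cj (Equiv.swap 0 a) (Equiv.swap 0 b))
    (d.c1_e (Nat.succ_pos _) (Nat.succ_pos _))
  rw [← F_zero, map_mul, map_mul, cj_F, cj_c, cj_cb] at this
  simpa using this

theorem c_F_comm {a' a} (b) (h : a' ≠ a) : Commute (d.c a') (d.F a b) := by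
  have h1 : Equiv.swap 0 a a' ≠ 0 := by
    intro h1
    have := congrArg (Equiv.swap 0 a) h1
    simp at this
    exact h this
  have := congrArg (d.cj (Equiv.swap 0 a) (Equiv.swap 0 b))
    (d.c_e_comm (Equiv.swap 0 a a') (fun h => h1 (Fin.ext h)))
  rw [← F_zero, map_mul, map_mul, cj_F, cj_c] at this
  simpa [Commute, SemiconjBy] using this

theorem cb_F_comm {b' b} (a) (h : b' ≠ b) : Commute (d.cb b') (d.F a b) := by
  have h1 : Equiv.swap 0 b b' ≠ 0 := by
    intro h1
    have := congrArg (Equiv.swap 0 b) h1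
    simp at this
    exact h this
  have := congrArg (d.cj (Equiv.swap 0 a) (Equiv.swap 0 b))
    (d.cb_e_comm (Equiv.swap 0 b b') (fun h => h1 (Fin.ext h)))
  rw [← F_zero, map_mul, map_mul, cj_F, cj_cb] at this
  simpa [Commute, SemiconjBy] using this

theorem one_lt_of_ne {n : ℕ} {x y : Fin (n + 1)} (h : x ≠ y) : 1 < n + 1 := by
  by_contra h1
  exact h (Fin.ext (by have := x.2; have := y.2; omega))

theorem F_s_F {a a'} (b) (h : a' ≠ a) :
    d.F a b * d.σ (Equiv.swap a' a) * d.F a b = d.F a b := by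
  have h1 := one_lt_of_ne h
  obtain ⟨w, hw0, hw1⟩ := s4_exists_perm (x := (0 : Fin (r + 1))) (y := ⟨1, h1⟩)
    (by simp [Fin.ext_iff]) h.symm
  have := congrArg (d.cj w (Equiv.swap 0 b)) (d.e_s_e h1)
  rw [s4_sw _ _ _ (by omega) h1, ← F_zero, map_mul, map_mul, cj_F, cj_swap, hw1,
    show (⟨0, by omega⟩ : Fin (r + 1)) = 0 from rfl, hw0] at this
  rw [Equiv.swap_comm]
  simpa using this

theorem F_sb_F {b b'} (a) (h : b' ≠ b) :
    d.F a b * d.σb (Equiv.swap b' b) * d.F a b = d.F a b := by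
  have h1 := one_lt_of_ne h
  obtain ⟨w, hw0, hw1⟩ := s4_exists_perm (x := (0 : Fin (t + 1))) (y := ⟨1, h1⟩)
    (by simp [Fin.ext_iff]) h.symm
  have := congrArg (d.cj (Equiv.swap 0 a) w) (d.e_sb_e h1)
  rw [s4_sw _ _ _ (by omega) h1, ← F_zero, map_mul, map_mul, cj_F, cj_swapb, hw1,
    show (⟨0, by omega⟩ : Fin (t + 1)) = 0 from rfl, hw0] at this
  rw [Equiv.swap_comm]
  simpa using this

theorem F_F_comm {a a' b b'} (ha : a ≠ a') (hb : b ≠ b') : Commute (d.F a b) (d.F a' b') := by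
  have h1 := one_lt_of_ne ha
  have h2 := one_lt_of_ne hb
  obtain ⟨w, hw0, hw1⟩ := s4_exists_perm (x := (0 : Fin (r + 1))) (y := ⟨1, h1⟩)
    (by simp [Fin.ext_iff]) ha
  obtain ⟨v, hv0, hv1⟩ := s4_exists_perm (x := (0 : Fin (t + 1))) (y := ⟨1, h2⟩)
    (by simp [Fin.ext_iff]) hb
  have b1 := d.braid1 h1 h2
  have b2 := d.braid2 h1 h2
  have hE : d.F ⟨1, h1⟩ ⟨1, h2⟩ = d.σ (sw (r + 1) 0 1) * d.σb (sw (t + 1) 0 1) * d.e *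
      d.σb (sw (t + 1) 0 1) * d.σ (sw (r + 1) 0 1) := by
    rw [F_alt, s4_sw _ _ _ (by omega) h1, s4_sw _ _ _ (by omega) h2]; rfl
  have hs : d.σ (sw (r + 1) 0 1) * d.σ (sw (r + 1) 0 1) = 1 := by
    rw [s4_sw _ _ _ (by omega) h1, σ_swap_sq]
  have hsb : d.σb (sw (t + 1) 0 1) * d.σb (sw (t + 1) 0 1) = 1 := by
    rw [s4_sw _ _ _ (by omega) h2, σb_swap_sq]
  have hc := d.comm_σσb (sw (r + 1) 0 1) (sw (t + 1) 0 1)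
  have base : d.F 0 0 * d.F ⟨1, h1⟩ ⟨1, h2⟩ = d.F ⟨1, h1⟩ ⟨1, h2⟩ * d.F 0 0 := by
    rw [hE, F_zero]
    generalize d.σ (sw (r + 1) 0 1) = s at *
    generalize d.σb (sw (t + 1) 0 1) = u at *
    generalize d.e = e at *
    calc e * (s * u * e * u * s) = (e * s * u * e * u) * s := by simp only [mul_assoc]
      _ = e * s * u * e * (s * s) := by rw [← b1]; simp only [mul_assoc]
      _ = (u * u) * e * s * u * e := by rw [hs, hsb]; simp
      _ = u * (s * e * s * u * e) := by rw [b2]; simp only [mul_assoc]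
      _ = (u * s) * e * (s * u) * e := by simp only [mul_assoc]
      _ = _ := by rw [← hc]; nth_rewrite 2 [hc]; simp only [mul_assoc]
  have := congrArg (d.cj w v) base
  rwa [map_mul, map_mul, cj_F, cj_F, hw0, hw1, hv0, hv1] at this

end WBC

theorem s4_sum_comm {A : Type} [Ring A] (I : Finset ℕ) (X T Z S : ℕ → A) (W : A)
    (hTS : ∀ j ∈ I, ∀ k ∈ I, Commute (T j) (S k))
    (hTZ : ∀ j ∈ I, ∀ k ∈ I, j ≠ k → Commute (T j) (Z k))
    (hTW : ∀ j ∈ I, Commute (T j) (Z j + W))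
    (hXS : ∀ j ∈ I, ∀ k ∈ I, j ≠ k → Commute (X j) (S k))
    (hXZ : ∀ j ∈ I, ∀ k ∈ I, Commute (X j) (Z k))
    (hXW : ∀ j ∈ I, Commute (X j) (W - S j)) :
    Commute ((∑ j ∈ I, X j) - ∑ j ∈ I, T j) (((∑ j ∈ I, Z j) - ∑ j ∈ I, S j) + W) := by
  refine Commute.sub_left (Commute.sum_left _ _ _ fun j hj => ?_)
    (Commute.sum_left _ _ _ fun j hj => ?_)
  · have : ((∑ j ∈ I, Z j) - ∑ j ∈ I, S j) + W
        = (∑ j ∈ I, Z j) - (∑ k ∈ I.erase j, S k) + (W - S j) := by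
      rw [← Finset.add_sum_erase I S hj]; abel
    rw [this]
    refine Commute.add_right (Commute.sub_right (Commute.sum_right _ _ _ fun k hk => hXZ j hj k hk)
      (Commute.sum_right _ _ _ fun k hk => ?_)) (hXW j hj)
    exact hXS j hj k (Finset.mem_of_mem_erase hk) (Finset.ne_of_mem_erase hk).symm
  · have : ((∑ j ∈ I, Z j) - ∑ j ∈ I, S j) + W
        = (∑ k ∈ I.erase j, Z k) - (∑ k ∈ I, S k) + (Z j + W) := by
      rw [← Finset.add_sum_erase I Z hj]; abel
    rw [this]
    refine Commute.add_right (Commute.sub_right (Commute.sum_right _ _ _ fun k hk => ?_)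
      (Commute.sum_right _ _ _ fun k hk => hTS j hj k hk)) (hTW j hj)
    exact hTZ j hj k (Finset.mem_of_mem_erase hk) (Finset.ne_of_mem_erase hk).symm

/-- `c g c` commutes with `x` if `c` anticommutes with `x` and `g` commutes with `x`. -/
theorem s4_anti {A : Type} [Ring A] {c g x : A} (h : c * x = -(x * c)) (hg : Commute g x) :
    Commute (c * g * c) x := by
  show c * g * c * x = x * (c * g * c)
  rw [mul_assoc, h, mul_neg, ← mul_assoc, mul_assoc c g x, hg.eq, ← mul_assoc c, h]
  simp only [neg_mul, neg_neg, mul_assoc]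

theorem s4_cGc {A : Type} [Ring A] {c : A} (g : A) (h : c * c = -1) :
    (g + c * g * c) * c = -(c * (g + c * g * c)) := by
  simp only [add_mul, mul_add, mul_assoc, h, s4_assoc h]; simp

theorem s4_bGb {A : Type} [Ring A] {c : A} (g : A) (h : c * c = 1) :
    (g - c * g * c) * c = -(c * (g - c * g * c)) := by
  simp only [sub_mul, mul_sub, mul_assoc, h, s4_assoc h]; simp

namespace WBC

variable {R A : Type} [CommRing R] [Ring A] [Algebra R A] {r t : ℕ}
variable (d : WBC R A (r + 1) (t + 1))

/-- Summands of `y`, `ȳ`. -/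
def fX (N : Fin (r + 1)) (b : Fin (t + 1)) : A := d.F N b + d.c N * d.F N b * d.c N

/-- Summands of `L`. -/
def fT (N a : Fin (r + 1)) : A :=
  d.σ (Equiv.swap a N) + d.c N * d.σ (Equiv.swap a N) * d.c N

/-- Summands of `ȳ`. -/
def fZ (M : Fin (t + 1)) (a : Fin (r + 1)) : A := d.F a M - d.c a * d.F a M * d.c a

/-- Summands of `L̄`. -/
def fS (M b : Fin (t + 1)) : A :=
  d.σb (Equiv.swap b M) - d.cb M * d.σb (Equiv.swap b M) * d.cb M

theorem T_cb (N a M) : Commute (d.fT N a) (d.cb M) :=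
  Commute.add_left (d.comm_σcb _ _) (s4_anti (d.anti_ccb _ _) (d.comm_σcb _ _))

theorem c_σb (N v) : Commute (d.c N) (d.σb v) := (d.comm_σbc v N).symm

theorem T_σb (N a v) : Commute (d.fT N a) (d.σb v) :=
  Commute.add_left (d.comm_σσb _ _)
    (((c_σb d N v).mul_left (d.comm_σσb _ _)).mul_left (c_σb d N v))

theorem T_S (N a M b) : Commute (d.fT N a) (d.fS M b) :=
  (d.T_σb _ _ _).sub_right (((d.T_cb _ _ _).mul_right (d.T_σb _ _ _)).mul_right (d.T_cb _ _ _))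

theorem T_F {N a k : Fin (r + 1)} (M) (h1 : k ≠ a) (h2 : k ≠ N) :
    Commute (d.fT N a) (d.F k M) := by
  have h : Commute (d.σ (Equiv.swap a N)) (d.F k M) := by
    have := d.σ_F (Equiv.swap a N) k M
    rwa [Equiv.swap_apply_of_ne_of_ne h1 h2] at this
  exact h.add_left (((d.c_F_comm M h2.symm).mul_left h).mul_left (d.c_F_comm M h2.symm))

theorem T_c {N a k : Fin (r + 1)} (h1 : k ≠ a) (h2 : k ≠ N) :
    Commute (d.fT N a) (d.c k) := by
  have h : Commute (d.σ (Equiv.swap a N)) (d.c k) := by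
    have := d.σ_c (Equiv.swap a N) k
    rwa [Equiv.swap_apply_of_ne_of_ne h1 h2] at this
  exact h.add_left (s4_anti (d.c_anti _ _ h2.symm) h)

theorem T_Z {N a k : Fin (r + 1)} (M) (h1 : k ≠ a) (h2 : k ≠ N) :
    Commute (d.fT N a) (d.fZ M k) :=
  (d.T_F M h1 h2).sub_right
    (((d.T_c h1 h2).mul_right (d.T_F M h1 h2)).mul_right (d.T_c h1 h2))

theorem X_cb (N) {b M : Fin (t + 1)} (h : M ≠ b) : Commute (d.fX N b) (d.cb M) :=
  (d.cb_F_comm N h).symm.add_left (s4_anti (d.anti_ccb _ _) (d.cb_F_comm N h).symm)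

theorem X_S (N) {b M j : Fin (t + 1)} (h : M ≠ b) (hj : b ≠ j) :
    Commute (d.fX N b) (d.fS M j) := by
  have h1 : Commute (d.F N b) (d.σb (Equiv.swap j M)) := by
    have := d.σb_F (Equiv.swap j M) N b
    rw [Equiv.swap_apply_of_ne_of_ne hj h.symm] at this
    exact this.symm
  have h2 : Commute (d.fX N b) (d.σb (Equiv.swap j M)) :=
    h1.add_left (((c_σb d N _).mul_left h1).mul_left (c_σb d N _))
  exact h2.sub_right (((d.X_cb N h).mul_right h2).mul_right (d.X_cb N h))

theorem X_Z {N k : Fin (r + 1)} {b M : Fin (t + 1)} (h : M ≠ b) (hk : k ≠ N) :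
    Commute (d.fX N b) (d.fZ M k) := by
  have h1 : Commute (d.fX N b) (d.F k M) :=
    (d.F_F_comm hk.symm h.symm).add_left
      (((d.c_F_comm M hk.symm).mul_left (d.F_F_comm hk.symm h.symm)).mul_left
        (d.c_F_comm M hk.symm))
  have h2 : Commute (d.fX N b) (d.c k) :=
    (d.c_F_comm b hk).symm.add_left (s4_anti (d.c_anti _ _ hk.symm) (d.c_F_comm b hk).symm)
  exact h1.sub_right ((h2.mul_right h1).mul_right h2)

theorem Z_c {k N : Fin (r + 1)} (M) (hk : k ≠ N) : Commute (d.fZ M k) (d.c N) :=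
  (d.c_F_comm M hk.symm).symm.sub_left
    (s4_anti (d.c_anti _ _ hk) (d.c_F_comm M hk.symm).symm)

theorem S_c (N M b) : Commute (d.fS M b) (d.c N) :=
  (c_σb d N _).symm.sub_left
    (s4_anti (by rw [d.anti_ccb, neg_neg]) (c_σb d N _).symm)

theorem X_anti (N b) : d.fX N b * d.c N = -(d.c N * d.fX N b) := s4_cGc _ (d.c_sq N)

theorem T_anti (N a) : d.fT N a * d.c N = -(d.c N * d.fT N a) := s4_cGc _ (d.c_sq N)

theorem X_rel (N) {b M : Fin (t + 1)} (h : b ≠ M) :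
    Commute (d.fX N b) (d.fZ M N - d.fS M b) ∧
    d.F N M * d.fX N b = d.F N M * d.fS M b ∧ d.fX N b * d.F N M = d.fS M b * d.F N M ∧
    d.F N M * d.fS M b * d.F N M = d.F N M + d.F N M := by
  have hF : d.F N b = d.σb (Equiv.swap b M) * d.F N M * d.σb (Equiv.swap b M) := by
    rw [d.σb_F, Equiv.swap_apply_right, mul_assoc, σb_swap_sq, mul_one]
  have hsb := d.σb_cb (Equiv.swap b M) M
  have hsf := d.σb_cb (Equiv.swap b M) b
  rw [Equiv.swap_apply_right] at hsb
  rw [Equiv.swap_apply_left] at hsf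
  obtain ⟨h1, h2, h3, h4, h5⟩ := s4_XS (d.F N M) (d.σb (Equiv.swap b M)) (d.c N) (d.cb M) (d.cb b)
    (d.F_sq _ _) (d.F_c_F _ _) (d.c_sq _) (d.cb_sq _) (d.cb_sq _) (d.F_c _ _) (d.c_F _ _)
    (d.cb_F_comm N h).symm.eq (d.σb_swap_sq _ _) (d.F_sb_F N h) hsb hsf (d.comm_σbc _ _)
    (by rw [d.anti_ccb, neg_neg]) (d.anti_ccb _ _) (d.cb_anti _ _ h.symm)
  rw [← hF] at h1 h2 h3 h4
  refine ⟨?_, h3, h4, h5⟩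
  show d.fX N b * (d.fZ M N - d.fS M b) = (d.fZ M N - d.fS M b) * d.fX N b
  rw [mul_sub, sub_mul]
  exact (sub_eq_zero.mpr h1).trans (sub_eq_zero.mpr h2).symm

theorem Z_rel {N a : Fin (r + 1)} (M) (h : a ≠ N) :
    Commute (d.fT N a) (d.fZ M a + d.fZ M N) ∧
    d.F N M * d.fZ M a = d.F N M * d.fT N a ∧ d.fZ M a * d.F N M = d.fT N a * d.F N M ∧
    d.F N M * d.fT N a * d.F N M = d.F N M + d.F N M := by
  have hF : d.F a M = d.σ (Equiv.swap a N) * d.F N M * d.σ (Equiv.swap a N) := by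
    rw [d.σ_F, Equiv.swap_apply_right, mul_assoc, σ_swap_sq, mul_one]
  have hsb := d.σ_c (Equiv.swap a N) N
  have hsf := d.σ_c (Equiv.swap a N) a
  rw [Equiv.swap_apply_right] at hsb
  rw [Equiv.swap_apply_left] at hsf
  obtain ⟨h1, h2, h3, h4⟩ := s4_ZT (d.F N M) (d.σ (Equiv.swap a N)) (d.c N) (d.c a)
    (d.F_sq _ _) (d.F_c_F _ _) (d.c_sq _) (d.c_sq _)
    (d.c_F_comm M h).symm.eq (d.σ_swap_sq _ _) (d.F_s_F M h) hsb hsf (d.c_anti _ _ h.symm)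
  rw [← hF] at h1 h2 h4
  exact ⟨h4, h1, h2, h3⟩

end WBC

/-- Lemma 2.11: `e_i ȳ_i^{2n+1} = ∑_{j=0}^n a^{(i)}_{2n+1,j} e_i y_i^{2j+1}`
with coefficients in `R[ω_{3,i}, …, ω_{2n-1,i}]` satisfying the stated recursion.
Here `ω : ℕ → A`, `a ↦ ω_{a,i}`, is characterized by the defining property of
Corollary 2.10. -/
theorem statement4 (R A : Type) [CommRing R] [IsDomain R] [Ring A] [Algebra R A]
    (h2 : IsUnit (2 : R)) (r t : ℕ) (hr : 1 ≤ r) (ht : 1 ≤ t)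
    (d : WBC R A r t) (hu : d.IsUniversal)
    (i : ℕ) (h1 : 1 ≤ i) (hir : i ≤ r) (hit : i ≤ t)
    (ω : ℕ → A)
    (hω : ∀ a : ℕ, ω a ∈ Algebra.adjoin R (d.lowerGens (i - 1)) ∧
      d.E i i * d.y i ^ a * d.E i i = ω a * d.E i i) :
    ∃ a : ℕ → ℕ → A,
      (∀ n j : ℕ, j ≤ n →
        a n j ∈ Algebra.adjoin R {x : A | ∃ l : ℕ, 1 ≤ l ∧ l + 1 ≤ n ∧ x = ω (2 * l + 1)}) ∧
      (∀ n : ℕ, d.E i i * d.yb i ^ (2 * n + 1)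
        = ∑ j ∈ Finset.range (n + 1), a n j * (d.E i i * d.y i ^ (2 * j + 1))) ∧
      (∀ n : ℕ, a n n = -1) ∧
      (∀ n j : ℕ, 1 ≤ j → j ≤ n → a n j = a (n - 1) (j - 1)) ∧
      (∀ n : ℕ, 1 ≤ n → a n 0 = ∑ j ∈ Finset.Ico 1 n, a (n - 1) j * ω (2 * j + 1)) := by
  obtain ⟨r, rfl⟩ : ∃ k, r = k + 1 := ⟨r - 1, by omega⟩
  obtain ⟨t, rfl⟩ : ∃ k, t = k + 1 := ⟨t - 1, by omega⟩
  set N : Fin (r + 1) := ⟨i - 1, by omega⟩ with hN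
  set M : Fin (t + 1) := ⟨i - 1, by omega⟩ with hM
  let p : ℕ → Fin (r + 1) := fun j => if h : j - 1 < r + 1 then ⟨j - 1, h⟩ else 0
  let q : ℕ → Fin (t + 1) := fun j => if h : j - 1 < t + 1 then ⟨j - 1, h⟩ else 0
  have hp : ∀ (j : ℕ) (hj : j ≤ i), p j = ⟨j - 1, by omega⟩ := fun j hj => by
    simp only [p]; rw [dif_pos (by omega)]
  have hq : ∀ (j : ℕ) (hj : j ≤ i), q j = ⟨j - 1, by omega⟩ := fun j hj => by
    simp only [q]; rw [dif_pos (by omega)]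
  have hpi : p i = N := hp i le_rfl
  have hqi : q i = M := hq i le_rfl
  have hpN : ∀ j ∈ Finset.Ico 1 i, p j ≠ N := by
    intro j hj
    rw [Finset.mem_Ico] at hj
    rw [hp j (by omega), hN]
    simp [Fin.ext_iff]; omega
  have hqM : ∀ j ∈ Finset.Ico 1 i, q j ≠ M := by
    intro j hj
    rw [Finset.mem_Ico] at hj
    rw [hq j (by omega), hM]
    simp [Fin.ext_iff]; omega
  have hpp : ∀ j ∈ Finset.Ico 1 i, ∀ k ∈ Finset.Ico 1 i, j ≠ k → p j ≠ p k := by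
    intro j hj k hk hjk
    rw [Finset.mem_Ico] at hj hk
    rw [hp j (by omega), hp k (by omega)]
    simp [Fin.ext_iff]; omega
  have hqq : ∀ j ∈ Finset.Ico 1 i, ∀ k ∈ Finset.Ico 1 i, j ≠ k → q j ≠ q k := by
    intro j hj k hk hjk
    rw [Finset.mem_Ico] at hj hk
    rw [hq j (by omega), hq k (by omega)]
    simp [Fin.ext_iff]; omega
  have htr : ∀ a b, a ≤ i → b ≤ i → d.tr a b = d.σ (Equiv.swap (p a) (p b)) := by
    intro a b ha hb
    rw [WBC.tr, s4_sw _ _ _ (by omega) (by omega), hp a ha, hp b hb]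
  have htrb : ∀ a b, a ≤ i → b ≤ i → d.trb a b = d.σb (Equiv.swap (q a) (q b)) := by
    intro a b ha hb
    rw [WBC.trb, s4_sw _ _ _ (by omega) (by omega), hq a ha, hq b hb]
  have hcn : ∀ a, a ≤ i → d.cn a = d.c (p a) := by
    intro a ha
    rw [WBC.cn, dif_pos (by omega), hp a ha]
  have hcbn : ∀ a, a ≤ i → d.cbn a = d.cb (q a) := by
    intro a ha
    rw [WBC.cbn, dif_pos (by omega), hq a ha]
  have hE : ∀ a b, a ≤ i → b ≤ i → d.E a b = d.F (p a) (q b) := by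
    intro a b ha hb
    rw [WBC.E, htr 1 a h1 ha, htrb 1 b h1 hb, hp 1 h1, hq 1 h1]
    rfl
  have hY : d.y i = (∑ j ∈ Finset.Ico 1 i, d.fX N (q j)) - ∑ j ∈ Finset.Ico 1 i, d.fT N (p j) := by
    rw [WBC.y, WBC.L, WBC.LL, Finset.mul_sum, Finset.sum_mul, ← Finset.sum_add_distrib]
    congr 1 <;> refine Finset.sum_congr rfl fun j hj => ?_
    · rw [Finset.mem_Ico] at hj
      rw [WBC.Eb, hE i j le_rfl (by omega), hcn i le_rfl, hpi, WBC.fX]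
    · rw [Finset.mem_Ico] at hj
      rw [htr j i (by omega) le_rfl, hcn i le_rfl, hpi, WBC.fT]
  have hYb : d.yb i
      = (∑ j ∈ Finset.Ico 1 i, d.fZ M (p j)) - ∑ j ∈ Finset.Ico 1 i, d.fS M (q j) := by
    rw [WBC.yb, WBC.Lb, WBC.LLb, Finset.mul_sum, Finset.sum_mul, ← Finset.sum_sub_distrib]
    congr 1 <;> refine Finset.sum_congr rfl fun j hj => ?_
    · rw [Finset.mem_Ico] at hj
      rw [WBC.Eb, hE j i (by omega) le_rfl, hcn j (by omega), hqi, WBC.fZ]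
    · rw [Finset.mem_Ico] at hj
      rw [htrb j i (by omega) le_rfl, hcbn i le_rfl, hqi, WBC.fS]
  have hEE : d.E i i = d.F N M := by rw [hE i i le_rfl le_rfl, hpi, hqi]
  have hω' : ∀ a, d.F N M * d.y i ^ a * d.F N M = ω a * d.F N M := fun a => by
    rw [← hEE]; exact (hω a).2
  rw [hEE]
  refine s4_main h2 (d.F N M) (d.y i) (d.yb i) (d.c N) (d.cb M) ω (d.F_sq _ _) (d.F_c_F _ _)
    (d.c_sq _) (d.cb_sq _) (d.F_c _ _) (d.c_F _ _) ?_ ?_ ?_ ?_ ?_ ?_ ?_ hω'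
  · rw [hY, sub_mul, mul_sub, Finset.sum_mul, Finset.sum_mul, Finset.mul_sum, Finset.mul_sum,
      neg_sub', ← Finset.sum_neg_distrib, ← Finset.sum_neg_distrib]
    simp only [d.X_anti, d.T_anti]
  · rw [hY]
    exact Commute.sub_left (Commute.sum_left _ _ _ fun j hj => d.X_cb N (hqM j hj).symm)
      (Commute.sum_left _ _ _ fun j _ => d.T_cb N (p j) M)
  · rw [hYb]
    exact Commute.sub_left (Commute.sum_left _ _ _ fun j hj => d.Z_c M (hpN j hj))
      (Commute.sum_left _ _ _ fun j _ => d.S_c N M (q j))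
  · rw [hY, hYb, mul_sub, mul_sub, Finset.mul_sum, Finset.mul_sum, Finset.mul_sum,
      Finset.mul_sum, neg_sub]
    congr 1 <;> refine Finset.sum_congr rfl fun j hj => ?_
    · exact (d.Z_rel M (hpN j hj)).2.1
    · exact (d.X_rel N (hqM j hj)).2.1.symm
  · rw [hY, hYb, sub_mul, sub_mul, Finset.sum_mul, Finset.sum_mul, Finset.sum_mul,
      Finset.sum_mul, neg_sub]
    congr 1 <;> refine Finset.sum_congr rfl fun j hj => ?_
    · exact (d.Z_rel M (hpN j hj)).2.2.1
    · exact (d.X_rel N (hqM j hj)).2.2.1.symm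
  · rw [hY, hYb]
    exact s4_sum_comm (Finset.Ico 1 i) (fun j => d.fX N (q j)) (fun j => d.fT N (p j))
      (fun j => d.fZ M (p j)) (fun j => d.fS M (q j)) (d.fZ M N)
      (fun j _ k _ => d.T_S _ _ _ _)
      (fun j hj k hk hjk => d.T_Z M (hpp j hj k hk hjk).symm (hpN k hk))
      (fun j hj => (d.Z_rel M (hpN j hj)).1)
      (fun j hj k hk hjk => d.X_S N (hqM j hj).symm (hqq j hj k hk hjk))
      (fun j hj k hk => d.X_Z (hqM j hj).symm (hpN k hk))
      (fun j hj => (d.X_rel N (hqM j hj)).1)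
  · rw [hY, mul_sub, sub_mul, Finset.mul_sum, Finset.mul_sum, Finset.sum_mul, Finset.sum_mul,
      ← Finset.sum_sub_distrib]
    refine Finset.sum_eq_zero fun j hj => ?_
    rw [(d.X_rel N (hqM j hj)).2.1, (d.X_rel N (hqM j hj)).2.2.2, (d.Z_rel M (hpN j hj)).2.2.2,
      sub_self]
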